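/- arXiv:2203.00767 — 4 statements merged into one kernel-verified Lean document; each statement's English description precedes it below -/
import Mathlib

section
/- If for a system Σ = (X,U,F) there exists a set ℛ that is (Q,T)-reach-spanning in some (𝒜,G), where 𝒜 is a finite cover of Q∖T and G : ∪_{t∈ℤ≥0} 𝒜^{[0;t]} → U, then (Q,T)-reachability is satisfiable for Σ: for every x₀ ∈ Q there is a sequence α ∈ ℛ with x₀ ∈ α(0), and every closed-loop trajectory obtained by applying the inputs G(α|_{[0;t]}) along cover elements tracked by ℛ reaches T in finite time without ever leaving Q. -/
open scoped Classical ENNReal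

/-- The element at index `t` of a finite sequence of sets (default `∅`). -/
def seqGet {X : Type*} (α : List (Set X)) (t : ℕ) : Set X := α.getD t ∅

/-- `𝒜` is a finite cover of `B`: a finite set of subsets of `B` whose union is `B`. -/
def IsCover {X : Type*} (𝒜 : Set (Set X)) (B : Set X) : Prop :=
  𝒜.Finite ∧ (∀ A ∈ 𝒜, A ⊆ B) ∧ ⋃₀ 𝒜 = B

/-- The set `P_ℛ` of successor cover elements of the prefix `pre = α|_[0;t]`
(of length `t + 1`). -/
def PSucc {X : Type*} (𝒜 : Set (Set X)) (T : Set X) (ℛ : Set (List (Set X)))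
    (pre : List (Set X)) : Set (Set X) :=
  {A | (A ∈ 𝒜 ∨ A = T) ∧
    ∃ β ∈ ℛ, β.take pre.length = pre ∧ pre.length < β.length ∧ seqGet β pre.length = A}

/-- `ℛ` is a `(Q,T)`-reach-spanning set in `(𝒜, G)`. -/
def ReachSpanning {X U : Type*} (F : X → U → Set X) (Q T : Set X)
    (𝒜 : Set (Set X)) (G : List (Set X) → U) (ℛ : Set (List (Set X))) : Prop :=
  ℛ.Finite ∧
  (∀ α ∈ ℛ, α ≠ [] ∧ ∀ A ∈ α, A ⊆ Q) ∧
  (Q = ⋃ α ∈ ℛ, seqGet α 0) ∧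
  (∀ α ∈ ℛ, (∀ t, t + 2 ≤ α.length → seqGet α t ∈ 𝒜) ∧ seqGet α (α.length - 1) = T) ∧
  (∀ α ∈ ℛ, ∀ t, t + 2 ≤ α.length →
    (⋃ x ∈ seqGet α t, F x (G (α.take (t + 1)))) ⊆ ⋃ A ∈ PSucc 𝒜 T ℛ (α.take (t + 1)), A)

/-- The set `ℛ₀` of first elements of members of `ℛ`, excluding the target set `T`. -/
def R0 {X : Type*} (T : Set X) (ℛ : Set (List (Set X))) : Set (Set X) :=
  {A | (∃ α ∈ ℛ, seqGet α 0 = A) ∧ A ≠ T}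

/-- The quantity `B(α)`. -/
noncomputable def Bval {X : Type*} (𝒜 : Set (Set X)) (T : Set X)
    (ℛ : Set (List (Set X))) (α : List (Set X)) : ℝ :=
  if α.length ≤ 1 then 0
  else (1 / ((α.length : ℝ) - 1)) *
    ((∑ t ∈ Finset.range (α.length - 2),
        Real.logb 2 ((PSucc 𝒜 T ℛ (α.take (t + 1)) \ {T}).ncard)) +
      Real.logb 2 ((R0 T ℛ).ncard))

/-- The quantity `N(ℛ)`, the largest value of `B` on `ℛ`. -/
noncomputable def Nval {X : Type*} (𝒜 : Set (Set X)) (T : Set X)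
    (ℛ : Set (List (Set X))) : ℝ :=
  sSup (Bval 𝒜 T ℛ '' ℛ)

/-- The `(Q,T)`-reachability entropy, with value `⊤` if `(Q,T)`-reachability is not
satisfiable. -/
noncomputable def entropy {X U : Type*} (F : X → U → Set X) (Q T : Set X) : ℝ≥0∞ :=
  sInf {e | ∃ (𝒜 : Set (Set X)) (G : List (Set X) → U) (ℛ : Set (List (Set X))),
    IsCover 𝒜 (Q \ T) ∧ ReachSpanning F Q T 𝒜 G ℛ ∧
    e = ENNReal.ofReal (Nval 𝒜 T ℛ)}

/-- `(Q,T)`-reachability is satisfiable: every state in `Q` can be steered to `T` in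
finite time, never leaving `Q`, using a feedback strategy taking finitely many input
values. -/
def Satisfiable {X U : Type*} (F : X → U → Set X) (Q T : Set X) : Prop :=
  ∃ Uf : Set U, Uf.Finite ∧ ∃ κ : List X → U, (∀ xs, κ xs ∈ Uf) ∧
    ∀ ξ : ℕ → X, ξ 0 ∈ Q →
      (∀ t, (∀ k ≤ t, ξ k ∉ T) →
        ξ (t + 1) ∈ F (ξ t) (κ (List.ofFn fun i : Fin (t + 1) => ξ i))) →
      ∃ n, ξ n ∈ T ∧ ∀ t < n, ξ t ∈ Q \ T

/-- Choice of the next cover element. -/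
noncomputable def selNext {X : Type*} (ℛ : Set (List (Set X))) (pre : List (Set X)) (x : X) :
    Set X :=
  if h : ∃ A : Set X, x ∈ A ∧ ∃ γ ∈ ℛ, pre ++ [A] <+: γ then h.choose else ∅

theorem selNext_spec {X : Type*} (ℛ : Set (List (Set X))) (pre : List (Set X)) (x : X)
    (h : ∃ A : Set X, x ∈ A ∧ ∃ γ ∈ ℛ, pre ++ [A] <+: γ) :
    x ∈ selNext ℛ pre x ∧ ∃ γ ∈ ℛ, pre ++ [selNext ℛ pre x] <+: γ := by
  unfold selNext
  rw [dif_pos h]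
  exact h.choose_spec

/-- The tracked sequence of cover elements along a history. -/
noncomputable def trackSeq {X : Type*} (ℛ : Set (List (Set X))) (xs : List X) : List (Set X) :=
  xs.foldl (fun pre x => pre ++ [selNext ℛ pre x]) []

theorem ofFn_snoc {Y : Type*} (f : ℕ → Y) (n : ℕ) :
    (List.ofFn fun i : Fin (n + 1) => f i) = (List.ofFn fun i : Fin n => f i) ++ [f n] := by
  rw [List.ofFn_succ', List.concat_eq_append]
  simp

theorem trackSeq_ofFn {X : Type*} (ℛ : Set (List (Set X))) (ξ : ℕ → X) (n : ℕ) :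
    trackSeq ℛ (List.ofFn fun i : Fin n => ξ i) =
      List.ofFn fun i : Fin n =>
        selNext ℛ (trackSeq ℛ (List.ofFn fun j : Fin (i : ℕ) => ξ j)) (ξ i) := by
  induction n with
  | zero => simp [trackSeq]
  | succ n ih =>
    rw [ofFn_snoc (fun i => selNext ℛ (trackSeq ℛ (List.ofFn fun j : Fin i => ξ j)) (ξ i)) n,
      ← ih, ofFn_snoc ξ n]
    simp [trackSeq]

theorem prefix_facts {X U : Type*} (F : X → U → Set X) (Q T : Set X)
    (𝒜 : Set (Set X)) (G : List (Set X) → U) (ℛ : Set (List (Set X)))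
    (hspan : ReachSpanning F Q T 𝒜 G ℛ) (β : ℕ → Set X) (t : ℕ) (γ : List (Set X))
    (hγ : γ ∈ ℛ) (hp : (List.ofFn fun i : Fin (t + 1) => β i) <+: γ) (x : X)
    (hx : x ∈ β t) (hT : x ∉ T) :
    t + 2 ≤ γ.length ∧ seqGet γ t = β t ∧
      γ.take (t + 1) = List.ofFn fun i : Fin (t + 1) => β i := by
  have hl := hp.length_le
  rw [List.length_ofFn] at hl
  have htake : γ.take (t + 1) = List.ofFn fun i : Fin (t + 1) => β i := by
    have := List.prefix_iff_eq_take.1 hp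
    rw [List.length_ofFn] at this
    exact this.symm
  have hget : seqGet γ t = β t := by
    obtain ⟨s, rfl⟩ := hp
    rw [ofFn_snoc β t]
    simp [seqGet, List.getD_eq_getElem?_getD]
  refine ⟨?_, hget, htake⟩
  by_contra hlt
  have hlen : γ.length - 1 = t := by omega
  have := (hspan.2.2.2.1 γ hγ).2
  rw [hlen, hget] at this
  exact hT (this ▸ hx)

theorem tracked_reach {X U : Type*} (F : X → U → Set X) (Q T : Set X)
    (𝒜 : Set (Set X)) (G : List (Set X) → U) (ℛ : Set (List (Set X)))
    (hcov : IsCover 𝒜 (Q \ T)) (hspan : ReachSpanning F Q T 𝒜 G ℛ)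
    (ξ : ℕ → X) (β : ℕ → Set X)
    (h : ∀ t, (∀ k ≤ t, ξ k ∉ T) →
          ξ t ∈ β t ∧ (∃ γ ∈ ℛ, (List.ofFn fun i : Fin (t + 1) => β i) <+: γ)) :
    ∃ n, ξ n ∈ T ∧ ∀ t < n, ξ t ∈ Q \ T := by
  have hex : ∃ n, ξ n ∈ T := by
    by_contra hno
    push Not at hno
    obtain ⟨M, hM⟩ := (hspan.1.image List.length).bddAbove
    obtain ⟨-, γ, hγ, hp⟩ := h M (fun k _ => hno k)
    have h1 := hM ⟨γ, hγ, rfl⟩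
    have h2 := hp.length_le
    rw [List.length_ofFn] at h2
    omega
  refine ⟨Nat.find hex, Nat.find_spec hex, fun t ht => ?_⟩
  have hnot : ∀ k ≤ t, ξ k ∉ T := fun k hk => Nat.find_min hex (lt_of_le_of_lt hk ht)
  obtain ⟨hx, γ, hγ, hp⟩ := h t hnot
  obtain ⟨h1, h2, -⟩ := prefix_facts F Q T 𝒜 G ℛ hspan β t γ hγ hp (ξ t) hx (hnot t le_rfl)
  have := (hspan.2.2.2.1 γ hγ).1 t h1
  rw [h2] at this
  exact hcov.2.1 _ this hx

theorem exists_start {X U : Type*} (F : X → U → Set X) (Q T : Set X)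
    (𝒜 : Set (Set X)) (G : List (Set X) → U) (ℛ : Set (List (Set X)))
    (hspan : ReachSpanning F Q T 𝒜 G ℛ) (x : X) (hx : x ∈ Q) :
    ∃ α ∈ ℛ, x ∈ seqGet α 0 := by
  rw [hspan.2.2.1] at hx
  simpa using hx

theorem satisfiable_aux {X U : Type*} (F : X → U → Set X) (Q T : Set X)
    (𝒜 : Set (Set X)) (G : List (Set X) → U) (ℛ : Set (List (Set X)))
    (hcov : IsCover 𝒜 (Q \ T)) (hspan : ReachSpanning F Q T 𝒜 G ℛ) :
    Satisfiable F Q T := by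
  have hfin : {l : List (Set X) | ∃ γ ∈ ℛ, l <+: γ}.Finite := by
    have : {l : List (Set X) | ∃ γ ∈ ℛ, l <+: γ} = ⋃ γ ∈ ℛ, {l | l ∈ γ.inits} := by
      ext l; simp
    rw [this]
    exact hspan.1.biUnion fun γ _ => List.finite_toSet _
  refine ⟨insert (G []) (G '' {l | ∃ γ ∈ ℛ, l <+: γ}), (hfin.image G).insert _,
    fun xs => if ∃ γ ∈ ℛ, trackSeq ℛ xs <+: γ then G (trackSeq ℛ xs) else G [], ?_, ?_⟩
  · intro xs
    dsimp only
    split_ifs with h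
    · exact Or.inr ⟨_, h, rfl⟩
    · exact Or.inl rfl
  intro ξ h0 hξ
  set β : ℕ → Set X := fun i =>
    selNext ℛ (trackSeq ℛ (List.ofFn fun j : Fin i => ξ j)) (ξ i) with hβ
  have htr : ∀ n, trackSeq ℛ (List.ofFn fun i : Fin n => ξ i) = List.ofFn fun i : Fin n => β i :=
    fun n => trackSeq_ofFn ℛ ξ n
  have key : ∀ t, (∃ A : Set X, ξ t ∈ A ∧ ∃ γ ∈ ℛ, (List.ofFn fun i : Fin t => β i) ++ [A] <+: γ) →
      ξ t ∈ β t ∧ (∃ γ ∈ ℛ, (List.ofFn fun i : Fin (t + 1) => β i) <+: γ) := by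
    intro t ht
    rw [ofFn_snoc β t]
    rw [← htr] at ht ⊢
    exact selNext_spec ℛ _ _ ht
  refine tracked_reach F Q T 𝒜 G ℛ hcov hspan ξ β ?_
  intro t
  induction t with
  | zero =>
    intro _
    apply key
    obtain ⟨α, hα, hx⟩ := exists_start F Q T 𝒜 G ℛ hspan _ h0
    refine ⟨seqGet α 0, hx, α, hα, ?_⟩
    cases α with
    | nil => exact absurd rfl (hspan.2.1 _ hα).1
    | cons a l => simp [seqGet]
  | succ t ih =>
    intro hnot
    have hnot' : ∀ k ≤ t, ξ k ∉ T := fun k hk => hnot k (by omega)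
    obtain ⟨hx, γ, hγ, hp⟩ := ih hnot'
    apply key
    obtain ⟨h1, h2, h3⟩ := prefix_facts F Q T 𝒜 G ℛ hspan β t γ hγ hp (ξ t) hx (hnot' t le_rfl)
    have hstep := hξ t hnot'
    beta_reduce at hstep
    rw [htr, if_pos ⟨γ, hγ, hp⟩] at hstep
    have hsub := hspan.2.2.2.2 γ hγ t h1
    rw [h2, h3] at hsub
    have hmem := hsub (Set.mem_biUnion hx hstep)
    obtain ⟨A, ⟨-, δ, hδ, hd1, hd2, hd3⟩, hA⟩ := Set.mem_iUnion₂.1 hmem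
    refine ⟨A, hA, δ, hδ, ?_⟩
    have : δ.take ((List.ofFn fun i : Fin (t + 1) => β i).length + 1)
        = (List.ofFn fun i : Fin (t + 1) => β i) ++ [A] := by
      rw [List.take_add_one, hd1, ← hd3, List.getElem?_eq_getElem hd2]
      simp only [seqGet, List.getD_eq_getElem?_getD, List.getElem?_eq_getElem hd2]
      rfl
    rw [← this]
    exact List.take_prefix _ _

/-- Lemma 1, "if" direction. If there is a `(Q,T)`-reach-spanning
set `ℛ` in some `(𝒜, G)`, then `(Q,T)`-reachability is satisfiable; moreover every
`x₀ ∈ Q` lies in the first element of some `α ∈ ℛ`, and every closed-loop trajectory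
obtained by applying the inputs `G (α|_[0;t])` along cover elements tracked by `ℛ`
reaches `T` in finite time without ever leaving `Q`. -/
theorem satisfiable_of_reach_spanning {X U : Type*} [Nonempty X] [Nonempty U]
    (F : X → U → Set X) (hF : ∀ x u, (F x u).Nonempty)
    (Q T : Set X) (hTQ : T ⊂ Q)
    (𝒜 : Set (Set X)) (G : List (Set X) → U) (ℛ : Set (List (Set X)))
    (hcov : IsCover 𝒜 (Q \ T)) (hspan : ReachSpanning F Q T 𝒜 G ℛ) :
    Satisfiable F Q T ∧
    ∀ x₀ ∈ Q, (∃ α ∈ ℛ, x₀ ∈ seqGet α 0) ∧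
      ∀ (ξ : ℕ → X) (β : ℕ → Set X), ξ 0 = x₀ →
        (∀ t, (∀ k ≤ t, ξ k ∉ T) →
          ξ t ∈ β t ∧
          (∃ γ ∈ ℛ, (List.ofFn fun i : Fin (t + 1) => β i) <+: γ) ∧
          ξ (t + 1) ∈ F (ξ t) (G (List.ofFn fun i : Fin (t + 1) => β i))) →
        ∃ n, ξ n ∈ T ∧ ∀ t < n, ξ t ∈ Q \ T := by
  refine ⟨satisfiable_aux F Q T 𝒜 G ℛ hcov hspan, fun x₀ hx₀ =>
    ⟨exists_start F Q T 𝒜 G ℛ hspan x₀ hx₀, fun ξ β _ h => ?_⟩⟩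
  exact tracked_reach F Q T 𝒜 G ℛ hcov hspan ξ β fun t ht => ⟨(h t ht).1, (h t ht).2.1⟩
end

section
/- Let Σ₁ = (X₁,U₁,F₁) and Σ₂ = (X₂,U₂,F₂) be systems, let T₁ ⊆ Q₁ ⊆ X₁ and T₂ ⊆ Q₂ ⊆ X₂ be nonempty sets. Suppose R ⊆ X₁ × X₂ is a feedback refinement relation from Σ₁ to Σ₂, Q₁ = R⁻¹(Q₂), T₁ = R⁻¹(T₂), #R(x₁) = 1 for all x₁ ∈ X₁, and R⁻¹(x₂) ≠ ∅ for all x₂ ∈ Q₂. Then the reachability entropies satisfy h₁(Q₁,T₁) ≤ h₂(Q₂,T₂). -/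
open scoped Classical ENNReal

/-- The image `R(B)` of a set `B ⊆ X₁` under the relation `R ⊆ X₁ × X₂`. -/
def relImg {X₁ X₂ : Type*} (R : Set (X₁ × X₂)) (B : Set X₁) : Set X₂ :=
  {x₂ | ∃ x₁ ∈ B, (x₁, x₂) ∈ R}

/-- The preimage `R⁻¹(B)` of a set `B ⊆ X₂` under the relation `R ⊆ X₁ × X₂`. -/
def relPre {X₁ X₂ : Type*} (R : Set (X₁ × X₂)) (B : Set X₂) : Set X₁ :=
  {x₁ | ∃ x₂ ∈ B, (x₁, x₂) ∈ R}

/-- `R` is a feedback refinement relation from `Σ₁ = (X₁, U₁, F₁)` to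
`Σ₂ = (X₂, U₂, F₂)`: `R` is strict and there is an interface map `r : U₂ → U₁` with
`R(F₁(x₁, r(u))) ⊆ F₂(x₂, u)` for all `(x₁, x₂) ∈ R` and `u ∈ U₂`. -/
def IsFRR {X₁ U₁ X₂ U₂ : Type*} (F₁ : X₁ → U₁ → Set X₁) (F₂ : X₂ → U₂ → Set X₂)
    (R : Set (X₁ × X₂)) : Prop :=
  (∀ x₁, ∃ x₂, (x₁, x₂) ∈ R) ∧
  ∃ r : U₂ → U₁, ∀ x₁ x₂, (x₁, x₂) ∈ R → ∀ u : U₂,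
    relImg R (F₁ x₁ (r u)) ⊆ F₂ x₂ u

/-- Taking preimages commutes with reading off an element. -/
theorem seqGet_map_preimage {X Y : Type*} (f : X → Y) (α : List (Set Y)) (t : ℕ) :
    seqGet (α.map (Set.preimage f)) t = f ⁻¹' seqGet α t := by
  unfold seqGet
  rw [List.getD_eq_getElem?_getD, List.getD_eq_getElem?_getD, List.getElem?_map]
  cases α[t]? <;> simp

theorem seqGet_subset {X : Type*} {Q : Set X} {α : List (Set X)} (h : ∀ A ∈ α, A ⊆ Q) (t : ℕ) :
    seqGet α t ⊆ Q := by
  unfold seqGet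
  rw [List.getD_eq_getElem?_getD]
  cases ht : α[t]? with
  | none => simp
  | some A => exact h A (List.mem_of_getElem? ht)

theorem map_image_map_preimage {X Y : Type*} (f : X → Y) {Q : Set Y} (hQ : Q ⊆ Set.range f)
    (α : List (Set Y)) (h : ∀ A ∈ α, A ⊆ Q) :
    (α.map (Set.preimage f)).map (Set.image f) = α := by
  rw [List.map_map]
  conv_rhs => rw [← List.map_id α]
  apply List.map_congr_left
  intro A hA
  exact Set.image_preimage_eq_of_subset ((h A hA).trans hQ)

theorem preimage_inj_sub {X Y : Type*} (f : X → Y) {Q : Set Y} (hQ : Q ⊆ Set.range f)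
    {A B : Set Y} (hA : A ⊆ Q) (hB : B ⊆ Q) (h : f ⁻¹' A = f ⁻¹' B) : A = B := by
  rw [← Set.image_preimage_eq_of_subset (hA.trans hQ), h,
    Set.image_preimage_eq_of_subset (hB.trans hQ)]

theorem PSucc_preimage {X Y : Type*} (f : X → Y) {Q T : Set Y} (hQ : Q ⊆ Set.range f)
    (hT : T ⊆ Q) {𝒜 : Set (Set Y)} (h𝒜 : ∀ A ∈ 𝒜, A ⊆ Q) {ℛ : Set (List (Set Y))}
    (hℛ : ∀ α ∈ ℛ, ∀ A ∈ α, A ⊆ Q) {pre : List (Set Y)} (hpre : ∀ A ∈ pre, A ⊆ Q) :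
    PSucc (Set.preimage f '' 𝒜) (f ⁻¹' T) (List.map (Set.preimage f) '' ℛ)
      (pre.map (Set.preimage f)) = Set.preimage f '' PSucc 𝒜 T ℛ pre := by
  ext B
  constructor
  · rintro ⟨hB, _, ⟨β, hβ, rfl⟩, htake, hlen, hget⟩
    rw [List.length_map] at htake hlen hget
    rw [List.length_map] at hlen
    rw [seqGet_map_preimage] at hget
    subst hget
    refine ⟨_, ⟨?_, β, hβ, ?_, hlen, rfl⟩, rfl⟩
    · have hs := seqGet_subset (hℛ β hβ) pre.length
      rcases hB with ⟨A, hA, hAB⟩ | hB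
      · left
        rw [← preimage_inj_sub f hQ (h𝒜 A hA) hs hAB]
        exact hA
      · right
        exact preimage_inj_sub f hQ hs hT hB
    · rw [← List.map_take] at htake
      rw [← map_image_map_preimage f hQ pre hpre, ← htake, map_image_map_preimage f hQ]
      · simp [List.length_take]
      · intro A hA
        exact hℛ β hβ A (List.mem_of_mem_take hA)
  · rintro ⟨A, ⟨hA, β, hβ, htake, hlen, hget⟩, rfl⟩
    refine ⟨?_, _, ⟨β, hβ, rfl⟩, ?_, ?_, ?_⟩
    · rcases hA with hA | rfl
      · exact Or.inl ⟨A, hA, rfl⟩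
      · exact Or.inr rfl
    · rw [List.length_map, ← List.map_take, htake]
    · simpa using hlen
    · rw [List.length_map, seqGet_map_preimage, hget]

theorem PSucc_subset {X : Type*} {Q T : Set X} (hT : T ⊆ Q) {𝒜 : Set (Set X)}
    (h𝒜 : ∀ A ∈ 𝒜, A ⊆ Q) (ℛ : Set (List (Set X))) (pre : List (Set X)) :
    ∀ A ∈ PSucc 𝒜 T ℛ pre, A ⊆ Q := by
  rintro A ⟨hA | rfl, -⟩
  · exact h𝒜 A hA
  · exact hT

theorem ncard_preimage_diff {X Y : Type*} (f : X → Y) {Q T : Set Y} (hQ : Q ⊆ Set.range f)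
    (hT : T ⊆ Q) {S : Set (Set Y)} (hS : ∀ A ∈ S, A ⊆ Q) :
    ((Set.preimage f '' S) \ {f ⁻¹' T}).ncard = (S \ {T}).ncard := by
  have h : (Set.preimage f '' S) \ {f ⁻¹' T} = Set.preimage f '' (S \ {T}) := by
    ext B
    constructor
    · rintro ⟨⟨A, hA, rfl⟩, hne⟩
      exact ⟨A, ⟨hA, fun h => hne (by rw [Set.mem_singleton_iff.1 h]; rfl)⟩, rfl⟩
    · rintro ⟨A, ⟨hA, hne⟩, rfl⟩
      exact ⟨⟨A, hA, rfl⟩, fun h => hne (preimage_inj_sub f hQ (hS A hA) hT h)⟩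
  rw [h]
  apply Set.ncard_image_of_injOn
  intro A hA B hB hAB
  exact preimage_inj_sub f hQ (hS A hA.1) (hS B hB.1) hAB

theorem R0_eq_diff {X : Type*} (T : Set X) (ℛ : Set (List (Set X))) :
    R0 T ℛ = ((fun α => seqGet α 0) '' ℛ) \ {T} := rfl

theorem Bval_preimage {X Y : Type*} (f : X → Y) {Q T : Set Y} (hQ : Q ⊆ Set.range f)
    (hT : T ⊆ Q) {𝒜 : Set (Set Y)} (h𝒜 : ∀ A ∈ 𝒜, A ⊆ Q) {ℛ : Set (List (Set Y))}
    (hℛ : ∀ α ∈ ℛ, ∀ A ∈ α, A ⊆ Q) {α : List (Set Y)} (hα : ∀ A ∈ α, A ⊆ Q) :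
    Bval (Set.preimage f '' 𝒜) (f ⁻¹' T) (List.map (Set.preimage f) '' ℛ)
      (α.map (Set.preimage f)) = Bval 𝒜 T ℛ α := by
  have h0 : (R0 (f ⁻¹' T) (List.map (Set.preimage f) '' ℛ)).ncard = (R0 T ℛ).ncard := by
    rw [R0_eq_diff, R0_eq_diff, ← ncard_preimage_diff f hQ hT, Set.image_image, Set.image_image]
    · simp only [seqGet_map_preimage]
    · rintro _ ⟨β, hβ, rfl⟩
      exact seqGet_subset (hℛ β hβ) 0
  unfold Bval
  rw [h0, List.length_map]
  have h1 : ∀ t, (PSucc (Set.preimage f '' 𝒜) (f ⁻¹' T) (List.map (Set.preimage f) '' ℛ)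
      ((α.map (Set.preimage f)).take (t + 1)) \ {f ⁻¹' T}).ncard =
      (PSucc 𝒜 T ℛ (α.take (t + 1)) \ {T}).ncard := by
    intro t
    rw [← List.map_take, PSucc_preimage f hQ hT h𝒜 hℛ
      (fun A hA => hα A (List.mem_of_mem_take hA))]
    exact ncard_preimage_diff f hQ hT (PSucc_subset hT h𝒜 ℛ _)
  simp only [h1]

/-- Theorem 2. If `R` is a feedback refinement relation from `Σ₁`
to `Σ₂`, `Q₁ = R⁻¹(Q₂)`, `T₁ = R⁻¹(T₂)`, `#R(x₁) = 1` for all `x₁ ∈ X₁`, and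
`R⁻¹(x₂) ≠ ∅` for all `x₂ ∈ Q₂`, then `h₁(Q₁,T₁) ≤ h₂(Q₂,T₂)`. -/
theorem entropy_le_of_FRR {X₁ U₁ X₂ U₂ : Type*}
    [Nonempty X₁] [Nonempty U₁] [Nonempty X₂] [Nonempty U₂]
    (F₁ : X₁ → U₁ → Set X₁) (F₂ : X₂ → U₂ → Set X₂)
    (hF₁ : ∀ x u, (F₁ x u).Nonempty) (hF₂ : ∀ x u, (F₂ x u).Nonempty)
    (Q₁ T₁ : Set X₁) (Q₂ T₂ : Set X₂)
    (hT₁ne : T₁.Nonempty) (hT₂ne : T₂.Nonempty)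
    (hT₁Q₁ : T₁ ⊆ Q₁) (hT₂Q₂ : T₂ ⊆ Q₂)
    (R : Set (X₁ × X₂)) (hFRR : IsFRR F₁ F₂ R)
    (hQ : Q₁ = relPre R Q₂) (hT : T₁ = relPre R T₂)
    (hsingle : ∀ x₁, ∃! x₂, (x₁, x₂) ∈ R)
    (hsur : ∀ x₂ ∈ Q₂, ∃ x₁, (x₁, x₂) ∈ R) :
    entropy F₁ Q₁ T₁ ≤ entropy F₂ Q₂ T₂ := by
  obtain ⟨-, r, hr⟩ := hFRR
  choose f hf hfu using hsingle
  have hpre : ∀ B : Set X₂, relPre R B = f ⁻¹' B := by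
    intro B
    ext x
    constructor
    · rintro ⟨y, hy, hxy⟩
      have := hfu x y hxy
      subst this
      exact hy
    · intro h
      exact ⟨f x, h, hf x⟩
  rw [hpre] at hQ hT
  subst hQ hT
  have hQr : Q₂ ⊆ Set.range f := by
    intro y hy
    obtain ⟨x, hx⟩ := hsur y hy
    exact ⟨x, (hfu x y hx).symm⟩
  unfold entropy
  apply sInf_le_sInf
  rintro e ⟨𝒜, G, ℛ, ⟨hfin, hsub, hcov⟩, ⟨hRfin, hRQ, hR0, hRT, hRF⟩, rfl⟩
  have h𝒜 : ∀ A ∈ 𝒜, A ⊆ Q₂ := fun A hA => (hsub A hA).trans Set.diff_subset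
  have hℛ : ∀ α ∈ ℛ, ∀ A ∈ α, A ⊆ Q₂ := fun α hα => (hRQ α hα).2
  refine ⟨Set.preimage f '' 𝒜, fun l => r (G (l.map (Set.image f))),
    List.map (Set.preimage f) '' ℛ, ⟨hfin.image _, ?_, ?_⟩,
    ⟨hRfin.image _, ?_, ?_, ?_, ?_⟩, ?_⟩
  · rintro _ ⟨A, hA, rfl⟩
    exact Set.preimage_mono (hsub A hA)
  · rw [← Set.preimage_diff, ← hcov, Set.sUnion_image, Set.preimage_sUnion]
  · rintro _ ⟨α, hα, rfl⟩
    refine ⟨by simpa using (hRQ α hα).1, ?_⟩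
    intro B hB
    obtain ⟨A, hA, rfl⟩ := List.mem_map.1 hB
    exact Set.preimage_mono (hℛ α hα A hA)
  · rw [Set.biUnion_image]
    conv_lhs => rw [hR0]
    simp only [seqGet_map_preimage, Set.preimage_iUnion]
  · rintro _ ⟨α, hα, rfl⟩
    simp only [seqGet_map_preimage, List.length_map]
    refine ⟨fun t ht => ⟨_, (hRT α hα).1 t ht, rfl⟩, ?_⟩
    rw [(hRT α hα).2]
  · rintro _ ⟨α, hα, rfl⟩ t ht
    rw [List.length_map] at ht
    have hα' : ∀ A ∈ α.take (t + 1), A ⊆ Q₂ := fun A hA => hℛ α hα A (List.mem_of_mem_take hA)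
    rw [← List.map_take, PSucc_preimage f hQr hT₂Q₂ h𝒜 hℛ hα', seqGet_map_preimage]
    simp only [map_image_map_preimage f hQr _ hα']
    intro y hy
    simp only [Set.mem_iUnion] at hy
    obtain ⟨x, hx, hy⟩ := hy
    have h2 : f y ∈ F₂ (f x) (G (α.take (t + 1))) := hr x (f x) (hf x) _ ⟨y, hy, hf y⟩
    have h3 := hRF α hα t ht (Set.mem_biUnion hx h2)
    simp only [Set.mem_iUnion] at h3
    obtain ⟨A, hA, hyA⟩ := h3
    exact Set.mem_biUnion (Set.mem_image_of_mem _ hA) hyA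
  · congr 1
    unfold Nval
    rw [Set.image_image]
    congr 1
    apply Set.image_congr
    intro α hα
    exact (Bval_preimage f hQr hT₂Q₂ h𝒜 hℛ (hℛ α hα)).symm
end

section
/- Let R be a feedback refinement relation from Σ₁ = (X₁,U₁,F₁) to Σ₂ = (X₂,U₂,F₂) with interface map r : U₂ → U₁, and assume Q₁ = R⁻¹(Q₂), T₁ = R⁻¹(T₂), #R(x₁) = 1 for all x₁ ∈ X₁, and R⁻¹(x₂) ≠ ∅ for all x₂ ∈ Q₂. Let ℛ₂ be a nontrivial (Q₂,T₂)-reach-spanning set in (𝒜₂,G₂). Define 𝒜₁ := {R⁻¹(A₂) : A₂ ∈ 𝒜₂}, ℛ₁ := {(R⁻¹(α(j)))_{j=0}^{τ−1} : α ∈ ℛ₂, τ = length(α)}, and G₁((R⁻¹(α(j)))_{j=0}^{i}) := r(G₂(α|_{[0;i]})). Then ℛ₁ is a (Q₁,T₁)-reach-spanning set in (𝒜₁,G₁). -/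
open scoped Classical ENNReal

theorem seqGet_map_relPre {X₁ X₂ : Type*} (R : Set (X₁ × X₂)) (α : List (Set X₂)) (t : ℕ) :
    seqGet (α.map (relPre R)) t = relPre R (seqGet α t) := by
  have h : relPre R (∅ : Set X₂) = ∅ := by
    ext x; simp [relPre]
  unfold seqGet
  rw [← h, List.getD_map]

theorem relImg_relPre {X₁ X₂ : Type*} (R : Set (X₁ × X₂)) (Q₂ : Set X₂)
    (hsingle : ∀ x₁, ∃! x₂, (x₁, x₂) ∈ R)
    (hsur : ∀ x₂ ∈ Q₂, ∃ x₁, (x₁, x₂) ∈ R) (A : Set X₂) (hA : A ⊆ Q₂) :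
    relImg R (relPre R A) = A := by
  ext y
  constructor
  · rintro ⟨x, ⟨z, hz, hxz⟩, hxy⟩
    rwa [(hsingle x).unique hxy hxz]
  · intro hy
    obtain ⟨x, hx⟩ := hsur y (hA hy)
    exact ⟨x, ⟨y, hy, hx⟩, hx⟩

/-- Let `R` be a feedback refinement relation from `Σ₁` to `Σ₂` with
interface map `r`, with `Q₁ = R⁻¹(Q₂)`, `T₁ = R⁻¹(T₂)`, `#R(x₁) = 1` for all `x₁`,
and `R⁻¹(x₂) ≠ ∅` for all `x₂ ∈ Q₂`. If `ℛ₂` is a nontrivial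
`(Q₂,T₂)`-reach-spanning set in `(𝒜₂, G₂)`, then with
`𝒜₁ := {R⁻¹(A₂) : A₂ ∈ 𝒜₂}`, `ℛ₁ := {(R⁻¹(α(j)))_j : α ∈ ℛ₂}`, and `G₁` defined on
the preimage sequences by `G₁((R⁻¹(α(j)))_{j≤i}) := r(G₂(α|_[0;i]))`, the set `ℛ₁`
is `(Q₁,T₁)`-reach-spanning in `(𝒜₁, G₁)`. -/
theorem reach_spanning_preimage_of_FRR {X₁ U₁ X₂ U₂ : Type*}
    [Nonempty X₁] [Nonempty U₁] [Nonempty X₂] [Nonempty U₂]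
    (F₁ : X₁ → U₁ → Set X₁) (F₂ : X₂ → U₂ → Set X₂)
    (hF₁ : ∀ x u, (F₁ x u).Nonempty) (hF₂ : ∀ x u, (F₂ x u).Nonempty)
    (Q₁ T₁ : Set X₁) (Q₂ T₂ : Set X₂)
    (hT₁ne : T₁.Nonempty) (hT₂ne : T₂.Nonempty)
    (hT₁Q₁ : T₁ ⊆ Q₁) (hT₂Q₂ : T₂ ⊆ Q₂)
    (R : Set (X₁ × X₂)) (r : U₂ → U₁)
    (hRstrict : ∀ x₁, ∃ x₂, (x₁, x₂) ∈ R)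
    (hfrr : ∀ x₁ x₂, (x₁, x₂) ∈ R → ∀ u : U₂, relImg R (F₁ x₁ (r u)) ⊆ F₂ x₂ u)
    (hQ : Q₁ = relPre R Q₂) (hT : T₁ = relPre R T₂)
    (hsingle : ∀ x₁, ∃! x₂, (x₁, x₂) ∈ R)
    (hsur : ∀ x₂ ∈ Q₂, ∃ x₁, (x₁, x₂) ∈ R)
    (𝒜₂ : Set (Set X₂)) (G₂ : List (Set X₂) → U₂) (ℛ₂ : Set (List (Set X₂)))
    (hcov₂ : IsCover 𝒜₂ (Q₂ \ T₂)) (hspan₂ : ReachSpanning F₂ Q₂ T₂ 𝒜₂ G₂ ℛ₂)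
    (hnontrivial : 1 < ℛ₂.ncard) :
    ∃ G₁ : List (Set X₁) → U₁,
      (∀ α ∈ ℛ₂, ∀ i < α.length,
        G₁ ((α.take (i + 1)).map (relPre R)) = r (G₂ (α.take (i + 1)))) ∧
      ReachSpanning F₁ Q₁ T₁ (relPre R '' 𝒜₂) G₁ (List.map (relPre R) '' ℛ₂) := by
  obtain ⟨hfin, hsub, hQc, hseq, hstep⟩ := hspan₂
  have hG : ∀ α ∈ ℛ₂, ∀ i, ((α.take (i + 1)).map (relPre R)).map (relImg R)
      = α.take (i + 1) := by
    intro α hα i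
    rw [List.map_map]
    conv_rhs => rw [← List.map_id (α.take (i + 1))]
    apply List.map_congr_left
    intro A hA
    exact relImg_relPre R Q₂ hsingle hsur A ((hsub α hα).2 A (List.mem_of_mem_take hA))
  refine ⟨fun l => r (G₂ (l.map (relImg R))), ?_, hfin.image _, ?_, ?_, ?_, ?_⟩
  · intro α hα i _
    simp only [hG α hα i]
  · rintro _ ⟨α, hα, rfl⟩
    refine ⟨by simpa using (hsub α hα).1, ?_⟩
    intro A hA
    obtain ⟨B, hB, rfl⟩ := List.mem_map.1 hA
    rw [hQ]
    rintro x ⟨y, hy, hxy⟩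
    exact ⟨y, (hsub α hα).2 B hB hy, hxy⟩
  · rw [hQ]
    ext x
    simp only [Set.mem_iUnion, Set.mem_image, exists_prop]
    constructor
    · rintro ⟨y, hy, hxy⟩
      rw [hQc] at hy
      simp only [Set.mem_iUnion, exists_prop] at hy
      obtain ⟨α, hα, hy⟩ := hy
      refine ⟨_, ⟨α, hα, rfl⟩, ?_⟩
      rw [seqGet_map_relPre]
      exact ⟨y, hy, hxy⟩
    · rintro ⟨_, ⟨α, hα, rfl⟩, hx⟩
      rw [seqGet_map_relPre] at hx
      obtain ⟨y, hy, hxy⟩ := hx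
      refine ⟨y, ?_, hxy⟩
      rw [hQc]
      simp only [Set.mem_iUnion, exists_prop]
      exact ⟨α, hα, hy⟩
  · rintro _ ⟨α, hα, rfl⟩
    refine ⟨?_, ?_⟩
    · intro t ht
      rw [seqGet_map_relPre]
      exact ⟨_, (hseq α hα).1 t (by simpa using ht), rfl⟩
    · rw [seqGet_map_relPre, List.length_map, (hseq α hα).2, hT]
  · rintro _ ⟨α, hα, rfl⟩ t ht y hy
    rw [List.length_map] at ht
    rw [← List.map_take, seqGet_map_relPre] at hy
    simp only [hG α hα t, Set.mem_iUnion, exists_prop] at hy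
    obtain ⟨x, ⟨x₂, hx₂, hxR⟩, hy⟩ := hy
    obtain ⟨y₂, hyR⟩ := hRstrict y
    have h2 : y₂ ∈ F₂ x₂ (G₂ (α.take (t + 1))) := hfrr x x₂ hxR _ ⟨y, hy, hyR⟩
    have h3 := hstep α hα t ht (Set.mem_biUnion hx₂ h2)
    simp only [Set.mem_iUnion, exists_prop] at h3 ⊢
    obtain ⟨A, ⟨hA, β, hβ, hpre, hlt, hget⟩, hyA⟩ := h3
    refine ⟨relPre R A, ⟨?_, β.map (relPre R), ⟨β, hβ, rfl⟩, ?_, ?_, ?_⟩, ⟨y₂, hyA, hyR⟩⟩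
    · rcases hA with hA | hA
      · exact Or.inl ⟨A, hA, rfl⟩
      · exact Or.inr (by rw [hA, hT])
    · rw [← List.map_take, ← List.map_take, List.length_map, hpre]
    · rw [← List.map_take, List.length_map, List.length_map]
      exact hlt
    · rw [← List.map_take, List.length_map, seqGet_map_relPre, hget]
end

section
/- Let R be a feedback refinement relation from Σ₁ = (X₁,U₁,F₁) to Σ₂ = (X₂,U₂,F₂) with interface map r : U₂ → U₁, and assume Q₁ = R⁻¹(Q₂), T₁ = R⁻¹(T₂), #R(x₁) = 1 for all x₁ ∈ X₁, and R⁻¹(x₂) ≠ ∅ for all x₂ ∈ Q₂. If the trivial set ℛ₂ = {T₂} is trivially (Q₂,T₂)-reach-spanning for Σ₂ with the single input u₂ (i.e., every state in Q₂∖T₂ reaches T₂ in finite time under the constant input u₂, without leaving Q₂), then ℛ₁ = {T₁} is trivially (Q₁,T₁)-reach-spanning for Σ₁ with the single input r(u₂): every trajectory of Σ₁ from any state in Q₁∖T₁ under the constant input r(u₂) reaches T₁ in finite time while remaining in Q₁∖T₁ until then. -/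
open scoped Classical ENNReal

/-- The set `{T}` is trivially `(Q,T)`-reach-spanning for the system `F` with the
single control value `u`: every trajectory under the constant input `u` from any
state in `Q \ T` reaches `T` in finite time while remaining in `Q \ T` until then. -/
def TrivSpanning {X U : Type*} (F : X → U → Set X) (Q T : Set X) (u : U) : Prop :=
  ∀ x ∈ Q \ T, ∀ ξ : ℕ → X, ξ 0 = x → (∀ t, ξ (t + 1) ∈ F (ξ t) u) →
    ∃ n, ξ n ∈ T ∧ ∀ t < n, ξ t ∈ Q \ T

/-- Let `R` be a feedback refinement relation from `Σ₁` to `Σ₂`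
with interface map `r`, with `Q₁ = R⁻¹(Q₂)`, `T₁ = R⁻¹(T₂)`, `#R(x₁) = 1` for all
`x₁`, and `R⁻¹(x₂) ≠ ∅` for all `x₂ ∈ Q₂`. If `ℛ₂ = {T₂}` is trivially
`(Q₂,T₂)`-reach-spanning with the single input `u₂`, then `ℛ₁ = {T₁}` is trivially
`(Q₁,T₁)`-reach-spanning with the single input `r(u₂)`. -/
theorem trivSpanning_of_FRR {X₁ U₁ X₂ U₂ : Type*}
    [Nonempty X₁] [Nonempty U₁] [Nonempty X₂] [Nonempty U₂]
    (F₁ : X₁ → U₁ → Set X₁) (F₂ : X₂ → U₂ → Set X₂)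
    (hF₁ : ∀ x u, (F₁ x u).Nonempty) (hF₂ : ∀ x u, (F₂ x u).Nonempty)
    (Q₁ T₁ : Set X₁) (Q₂ T₂ : Set X₂)
    (hT₁ne : T₁.Nonempty) (hT₂ne : T₂.Nonempty)
    (hT₁Q₁ : T₁ ⊆ Q₁) (hT₂Q₂ : T₂ ⊆ Q₂)
    (R : Set (X₁ × X₂)) (r : U₂ → U₁)
    (hRstrict : ∀ x₁, ∃ x₂, (x₁, x₂) ∈ R)
    (hfrr : ∀ x₁ x₂, (x₁, x₂) ∈ R → ∀ u : U₂, relImg R (F₁ x₁ (r u)) ⊆ F₂ x₂ u)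
    (hQ : Q₁ = relPre R Q₂) (hT : T₁ = relPre R T₂)
    (hsingle : ∀ x₁, ∃! x₂, (x₁, x₂) ∈ R)
    (hsur : ∀ x₂ ∈ Q₂, ∃ x₁, (x₁, x₂) ∈ R)
    (u₂ : U₂) (htriv : TrivSpanning F₂ Q₂ T₂ u₂) :
    TrivSpanning F₁ Q₁ T₁ (r u₂) := by
  choose f hf huniq using hsingle
  have key : ∀ (B : Set X₂) (x : X₁), x ∈ relPre R B ↔ f x ∈ B := by
    intro B x
    constructor
    · rintro ⟨y, hy, hxy⟩
      have h : y = f x := huniq x y hxy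
      exact h ▸ hy
    · intro h
      exact ⟨f x, h, hf x⟩
  subst hQ hT
  intro x hx ξ h0 hξ
  obtain ⟨n, hn, hlt⟩ := htriv (f x)
    ⟨(key _ _).1 hx.1, fun h => hx.2 ((key _ _).2 h)⟩
    (fun t => f (ξ t)) (congrArg f h0)
    (fun t => hfrr _ _ (hf (ξ t)) u₂ ⟨ξ (t + 1), hξ t, hf _⟩)
  exact ⟨n, (key _ _).2 hn, fun t ht =>
    ⟨(key _ _).2 (hlt t ht).1, fun h => (hlt t ht).2 ((key _ _).1 h)⟩⟩
end
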